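/- Let n be a natural number, let H : (EuclideanSpace ℝ (Fin n)) × (EuclideanSpace ℝ (Fin n)) → ℝ and f : EuclideanSpace ℝ (Fin n) → ℝ be smooth (C^∞) functions, and fix x ∈ EuclideanSpace ℝ (Fin n). Then there exist ε₀ > 0 and continuously differentiable curves y, p : ℝ → EuclideanSpace ℝ (Fin n) with y 0 = x and p 0 = gradient f x such that for all ε with |ε| < ε₀ one has y ε = x + ε • (gradient (fun q => H (x, q)) (p ε)) and p ε = gradient f (y ε). (Existence of the solutions to the microformal pullback equations for the thick diffeomorphism with generating function S(x,p) = x·p + εH(x,p), by the implicit function theorem.) -/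

import Mathlib

open scoped Topology

/-- A function that is `C^n` at a point agrees near that point with a globally `C^n` function. -/
theorem ContDiffAt.exists_contDiff_eventuallyEq {E F : Type*} [NormedAddCommGroup E]
    [NormedSpace ℝ E] [HasContDiffBump E] [FiniteDimensional ℝ E] [NormedAddCommGroup F]
    [NormedSpace ℝ F] {n : ℕ} {g : E → F} {a : E} (hg : ContDiffAt ℝ n g a) :
    ∃ h : E → F, ContDiff ℝ n h ∧ h =ᶠ[𝓝 a] g := by
  obtain ⟨r, hr, hball⟩ := Metric.eventually_nhds_iff_ball.1 (hg.eventually (by simp))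
  let χ : ContDiffBump a := ⟨r / 4, r / 2, by positivity, by linarith⟩
  refine ⟨fun t => χ t • g t, contDiff_iff_contDiffAt.2 fun t => ?_, ?_⟩
  · by_cases ht : t ∈ tsupport χ
    · rw [χ.tsupport_eq] at ht
      exact χ.contDiff.contDiffAt.smul
        (hball t (Metric.closedBall_subset_ball (half_lt_self hr) ht))
    · refine contDiffAt_const (c := (0 : F)) |>.congr_of_eventuallyEq ?_
      filter_upwards [notMem_tsupport_iff_eventuallyEq.1 ht] with s hs
      simp [hs]
  · filter_upwards [χ.eventuallyEq_one] with t ht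
    simp [ht]

/-- The gradient of a `C^m` function is `C^n` whenever `n + 1 ≤ m`. -/
theorem ContDiff.gradient_right {E : Type*} [NormedAddCommGroup E] [InnerProductSpace ℝ E]
    [CompleteSpace E] {m n : WithTop ℕ∞} {g : E → ℝ} (hg : ContDiff ℝ m g) (hmn : n + 1 ≤ m) :
    ContDiff ℝ n (gradient g) :=
  (InnerProductSpace.toDual ℝ E).symm.toContinuousLinearEquiv.contDiff.comp
    (hg.fderiv_right hmn)

/-- For a `C¹` map `V`, the equation `y = x + ε • V y` has a `C¹` solution curve through `x`
for small `ε`. -/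
theorem ContDiff.exists_curve_eq_add_smul {E : Type*} [NormedAddCommGroup E] [NormedSpace ℝ E]
    [CompleteSpace E] {V : E → E} (hV : ContDiff ℝ 1 V) (x : E) :
    ∃ y : ℝ → E, ContDiff ℝ 1 y ∧ y 0 = x ∧ ∀ᶠ ε in 𝓝 (0 : ℝ), y ε = x + ε • V (y ε) := by
  let G : ℝ × E → E := fun u => u.2 - u.1 • V u.2
  have hG : ContDiff ℝ 1 G := by fun_prop
  have hGat : ContDiffAt ℝ 1 G (0, x) := hG.contDiffAt
  have hpartial : fderiv ℝ G (0, x) ∘L .inr ℝ ℝ E = .id ℝ E := by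
    have hd : HasFDerivAt (fun v : E => G (0, v)) (fderiv ℝ G (0, x) ∘L .inr ℝ ℝ E) x :=
      (hG.differentiable one_ne_zero (0, x)).hasFDerivAt.comp x (hasFDerivAt_prodMk_right 0 x)
    refine hd.unique ?_
    have hGid : (fun v : E => G (0, v)) = id := by ext v; simp [G]
    exact hGid ▸ hasFDerivAt_id x
  have hinv : (fderiv ℝ G (0, x) ∘L .inr ℝ ℝ E).IsInvertible :=
    ⟨.refl ℝ E, hpartial.symm⟩
  obtain ⟨y, hy, hyeq⟩ := ContDiffAt.exists_contDiff_eventuallyEq (n := 1)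
    (hGat.contDiffAt_implicitFunction one_ne_zero hinv)
  refine ⟨y, hy, ?_, ?_⟩
  · exact hyeq.eq_of_nhds.trans (hGat.implicitFunction_apply_self one_ne_zero hinv)
  · filter_upwards [hyeq, hGat.eventually_apply_implicitFunction one_ne_zero hinv] with ε h₁ h₂
    rw [← h₁] at h₂
    exact sub_eq_iff_eq_add.1 (by simpa [G] using h₂)

/-- Existence of solutions to the microformal pullback equations for the thick
diffeomorphism with generating function `S(x,p) = x·p + εH(x,p)`, via the
implicit function theorem: there are `C¹` curves `y, p` with `y 0 = x`,
`p 0 = gradient f x` solving the equations for all small `ε`. -/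
theorem microformal_pullback_equations_solvable (n : ℕ)
    (H : (EuclideanSpace ℝ (Fin n)) × (EuclideanSpace ℝ (Fin n)) → ℝ)
    (f : EuclideanSpace ℝ (Fin n) → ℝ)
    (hH : ContDiff ℝ (⊤ : ℕ∞) H) (hf : ContDiff ℝ (⊤ : ℕ∞) f)
    (x : EuclideanSpace ℝ (Fin n)) :
    ∃ ε₀ : ℝ, 0 < ε₀ ∧
      ∃ y p : ℝ → EuclideanSpace ℝ (Fin n),
        ContDiff ℝ 1 y ∧ ContDiff ℝ 1 p ∧
        y 0 = x ∧ p 0 = gradient f x ∧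
        ∀ ε : ℝ, |ε| < ε₀ →
          y ε = x + ε • (gradient (fun q => H (x, q)) (p ε)) ∧
          p ε = gradient f (y ε) := by
  have hgradf : ContDiff ℝ 1 (gradient f) :=
    hf.gradient_right (WithTop.coe_le_coe.2 (le_top : (1 + 1 : ℕ∞) ≤ ⊤))
  have hHx : ContDiff ℝ (⊤ : ℕ∞) fun q => H (x, q) := by fun_prop
  have hgradH : ContDiff ℝ 1 (gradient fun q => H (x, q)) :=
    hHx.gradient_right (WithTop.coe_le_coe.2 (le_top : (1 + 1 : ℕ∞) ≤ ⊤))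
  obtain ⟨y, hy, hy0, hyeq⟩ := (hgradH.comp hgradf).exists_curve_eq_add_smul x
  obtain ⟨ε₀, hε₀, hball⟩ := Metric.eventually_nhds_iff.1 hyeq
  exact ⟨ε₀, hε₀, y, fun ε => gradient f (y ε), hy, hgradf.comp hy, hy0, congrArg (gradient f) hy0,
    fun ε hε => ⟨hball (by simpa using hε), rfl⟩⟩
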